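/- arXiv:math/0610102 — 5 statements merged into one kernel-verified Lean document; each statement's English description precedes it below -/
import Mathlib

section
/- Let C be an admissible capacity on X. (i) If Q ⊆ X is q-open, then the set Q̌ := X∖b(X∖Q) is q-open, Q ⊆ Q̌, Q̌ ∼q Q, and every q-open set Q′ with Q′ ∼q Q satisfies Q′ ⊆ Q̌ (Q̌ is the largest q-open set q-equivalent to Q). (ii) If F ⊆ X is q-closed, then b(F) is q-closed, b(F) ⊆ F, b(F) ∼q F, and every q-closed set F′ with F′ ∼q F satisfies b(F) ⊆ F′ (b(F) is the smallest q-closed set q-equivalent to F). -/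
open Set Metric Filter MeasureTheory ENNReal

noncomputable section

/-- A capacity on a metric space `X`: a monotone, countably subadditive
set function vanishing on the empty set, with values in `[0,∞]`. -/
structure Capacity (X : Type*) [MetricSpace X] where
  toFun : Set X → ℝ≥0∞
  empty' : toFun ∅ = 0
  mono' : ∀ ⦃A B : Set X⦄, A ⊆ B → toFun A ≤ toFun B
  subadd' : ∀ A : ℕ → Set X, toFun (⋃ n, A n) ≤ ∑' n, toFun (A n)

variable {X : Type*} [MetricSpace X]

/-- The set of `q`-thick points of `A`: points `ξ` where the series
`∑ (2^{nγ} C(A ∩ B̄(ξ,2^{-n})))^{q-1}` diverges. -/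
def Capacity.thick (C : Capacity X) (q γ : ℝ) (A : Set X) : Set X :=
  {ξ : X | ∑' n : ℕ,
    ((2 : ℝ≥0∞) ^ ((n : ℝ) * γ) * C.toFun (A ∩ closedBall ξ ((2 : ℝ) ^ (-(n : ℝ))))) ^ (q - 1) = ⊤}

/-- The `q`-fine closure of a set: `Ã = A ∪ b(A)`. -/
def Capacity.fineClosure (C : Capacity X) (q γ : ℝ) (A : Set X) : Set X :=
  A ∪ C.thick q γ A

/-- The `q`-fine interior of a set: `A° = A \ b(X∖A)`. -/
def Capacity.fineInterior (C : Capacity X) (q γ : ℝ) (A : Set X) : Set X :=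
  A \ C.thick q γ Aᶜ

/-- A set is `q`-closed if it contains all its `q`-thick points. -/
def Capacity.QClosed (C : Capacity X) (q γ : ℝ) (F : Set X) : Prop :=
  C.thick q γ F ⊆ F

/-- A set is `q`-open if its complement is `q`-closed. -/
def Capacity.QOpen (C : Capacity X) (q γ : ℝ) (A : Set X) : Prop :=
  C.QClosed q γ Aᶜ

/-- `A ⊆q B` : `A` is `q`-essentially contained in `B`, i.e. `C(A∖B) = 0`. -/
def Capacity.Subq (C : Capacity X) (A B : Set X) : Prop := C.toFun (A \ B) = 0

/-- `A ∼q B` : `A` and `B` are `q`-equivalent, i.e. `C(AΔB) = 0`. -/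
def Capacity.Eqq (C : Capacity X) (A B : Set X) : Prop :=
  C.toFun ((A \ B) ∪ (B \ A)) = 0

/-- A set `E` is `q`-quasi closed: there is an increasing sequence of compact
subsets `K m ⊆ E` with `C(E∖K m) → 0`. -/
def Capacity.QuasiClosed (C : Capacity X) (E : Set X) : Prop :=
  ∃ K : ℕ → Set X, Monotone K ∧ (∀ m, IsCompact (K m)) ∧ (∀ m, K m ⊆ E) ∧
    Tendsto (fun m => C.toFun (E \ K m)) atTop (nhds 0)

/-- An admissible capacity: all the regularity, Kellogg, stratification,
patching and quasi-Lindelöf properties of the Bessel capacity `C_{2/q,q'}`. -/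
structure Capacity.Admissible [CompactSpace X] [MeasurableSpace X] [BorelSpace X]
    (C : Capacity X) (q γ : ℝ) : Prop where
  finite : C.toFun univ ≠ ⊤
  outerRegular : ∀ E : Set X, C.toFun E = ⨅ (G : Set X) (_ : E ⊆ G) (_ : IsOpen G), C.toFun G
  contIncr : ∀ E : ℕ → Set X, Monotone E →
    Tendsto (fun i => C.toFun (E i)) atTop (nhds (C.toFun (⋃ i, E i)))
  contDecrCompact : ∀ K : ℕ → Set X, (∀ i, IsCompact (K i)) → Antitone K →
    Tendsto (fun i => C.toFun (K i)) atTop (nhds (C.toFun (⋂ i, K i)))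
  innerRegular : ∀ E : Set X, MeasurableSet E →
    C.toFun E = ⨆ (K : Set X) (_ : K ⊆ E) (_ : IsCompact K), C.toFun K
  kellogg : ∀ A : Set X, C.toFun (A \ C.thick q γ A) = 0
  closureBound : ∃ c : ℝ≥0∞, 1 ≤ c ∧ c ≠ ⊤ ∧
    ∀ A : Set X, C.toFun (C.fineClosure q γ A) ≤ c * C.toFun A
  closureQClosed : ∀ A : Set X, C.QClosed q γ (C.fineClosure q γ A)
  stratification : ∀ E : Set X, C.QClosed q γ E → C.QuasiClosed E
  thickQuasi : ∀ E : Set X, C.QuasiClosed E → C.toFun (C.thick q γ E \ E) = 0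
  openPatch : ∀ D : Set X, C.QOpen q γ D → ∀ ε : ℝ≥0∞, 0 < ε →
    ∃ ω : Set X, IsOpen ω ∧ C.toFun ω < ε ∧ IsOpen (D ∪ ω)
  quasiLindelof : ∀ 𝒟 : Set (Set X), (∀ D ∈ 𝒟, C.QOpen q γ D) →
    ∃ 𝒟' ⊆ 𝒟, 𝒟'.Countable ∧ C.toFun ((⋃₀ 𝒟) \ ⋃₀ 𝒟') = 0

/-- A Borel measure is outer regular with respect to the `q`-topology. -/
def Capacity.OuterRegularQ [MeasurableSpace X] (C : Capacity X) (q γ : ℝ) (μ : Measure X) : Prop :=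
  ∀ E : Set X, MeasurableSet E → μ E = ⨅ (Q : Set X) (_ : E ⊆ Q) (_ : C.QOpen q γ Q), μ Q

/-- A Borel measure is essentially absolutely continuous with respect to `C`. -/
def Capacity.EssAbsCont [MeasurableSpace X] (C : Capacity X) (q γ : ℝ) (μ : Measure X) : Prop :=
  ∀ Q : Set X, C.QOpen q γ Q → ∀ A : Set X, MeasurableSet A → C.toFun A = 0 → μ (Q \ A) = μ Q

/-- A `q`-perfect measure: outer regular w.r.t. the `q`-topology and
essentially absolutely continuous w.r.t. `C`. -/
def Capacity.QPerfect [MeasurableSpace X] (C : Capacity X) (q γ : ℝ) (μ : Measure X) : Prop :=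
  C.OuterRegularQ q γ μ ∧ C.EssAbsCont q γ μ

theorem Capacity.union_le (C : Capacity X) (A B : Set X) :
    C.toFun (A ∪ B) ≤ C.toFun A + C.toFun B := by
  have h := C.subadd' (fun n : ℕ => if n = 0 then A else if n = 1 then B else ∅)
  rw [tsum_eq_sum (s := Finset.range 2)] at h
  · simp only [Finset.sum_range_succ, Finset.sum_range_zero, zero_add, if_true, one_ne_zero,
      if_false] at h
    refine (C.mono' ?_).trans h
    rintro x (hx | hx)
    · exact mem_iUnion.2 ⟨0, by simpa using hx⟩
    · exact mem_iUnion.2 ⟨1, by simpa using hx⟩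
  · intro n hn
    have hn' : n ≠ 0 ∧ n ≠ 1 := by
      simp only [Finset.mem_range] at hn
      omega
    simp [hn'.1, hn'.2, C.empty']

/-- The set of thick points is monotone with respect to essential inclusion. -/
theorem Capacity.thick_subset_of_subq (C : Capacity X) {q : ℝ} (γ : ℝ) (hq : 1 ≤ q) {A B : Set X}
    (h : C.Subq A B) : C.thick q γ A ⊆ C.thick q γ B := by
  intro ξ hξ
  refine top_unique (le_trans (le_of_eq (Eq.symm hξ)) (ENNReal.tsum_le_tsum fun n => ?_))
  refine ENNReal.rpow_le_rpow (mul_le_mul_right ?_ _) (by linarith)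
  set K := closedBall ξ ((2 : ℝ) ^ (-(n : ℝ)))
  calc C.toFun (A ∩ K) ≤ C.toFun (B ∩ K ∪ A \ B) := C.mono' fun x hx => by
        by_cases hB : x ∈ B
        · exact Or.inl ⟨hB, hx.2⟩
        · exact Or.inr ⟨hx.1, hB⟩
    _ ≤ C.toFun (B ∩ K) + C.toFun (A \ B) := C.union_le _ _
    _ = C.toFun (B ∩ K) := by rw [h, add_zero]

theorem Capacity.Eqq.symm {C : Capacity X} {A B : Set X} (h : C.Eqq A B) : C.Eqq B A := by
  rwa [Capacity.Eqq, union_comm]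

theorem Capacity.Eqq.subq {C : Capacity X} {A B : Set X} (h : C.Eqq A B) : C.Subq A B :=
  le_zero_iff.1 ((C.mono' subset_union_left).trans_eq h)

theorem Capacity.Eqq.compl {C : Capacity X} {A B : Set X} (h : C.Eqq A B) : C.Eqq Aᶜ Bᶜ := by
  unfold Capacity.Eqq at *
  rwa [compl_sdiff_compl, compl_sdiff_compl, union_comm]

/-- The thick points of a `q`-closed set form the smallest `q`-closed set equivalent to it. -/
theorem Capacity.Admissible.thick_of_qClosed [CompactSpace X] [MeasurableSpace X] [BorelSpace X]
    {C : Capacity X} {q γ : ℝ} (hC : C.Admissible q γ) (hq : 1 ≤ q) {F : Set X}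
    (hF : C.QClosed q γ F) :
    C.QClosed q γ (C.thick q γ F) ∧ C.thick q γ F ⊆ F ∧ C.Eqq (C.thick q γ F) F ∧
      ∀ F' : Set X, C.QClosed q γ F' → C.Eqq F' F → C.thick q γ F ⊆ F' := by
  have hE : C.Eqq (C.thick q γ F) F := by
    rw [Capacity.Eqq, sdiff_eq_empty.2 hF, empty_union]
    exact hC.kellogg F
  exact ⟨C.thick_subset_of_subq γ hq hE.subq, hF, hE, fun F' hF' h =>
    (C.thick_subset_of_subq γ hq h.symm.subq).trans hF'⟩

theorem stmt10 {X : Type*} [MetricSpace X] [CompactSpace X] [MeasurableSpace X] [BorelSpace X]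
    (N : ℕ) (hN : 2 ≤ N) (q γ : ℝ) (hq : ((N : ℝ) + 1) / ((N : ℝ) - 1) ≤ q)
    (hγ : γ = (N : ℝ) - 1 - 2 / (q - 1))
    (C : Capacity X) (hC : C.Admissible q γ) :
    (∀ Q : Set X, C.QOpen q γ Q →
      C.QOpen q γ (C.thick q γ Qᶜ)ᶜ ∧
      Q ⊆ (C.thick q γ Qᶜ)ᶜ ∧
      C.Eqq ((C.thick q γ Qᶜ)ᶜ) Q ∧
      (∀ Q' : Set X, C.QOpen q γ Q' → C.Eqq Q' Q → Q' ⊆ (C.thick q γ Qᶜ)ᶜ)) ∧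
    (∀ F : Set X, C.QClosed q γ F →
      C.QClosed q γ (C.thick q γ F) ∧
      C.thick q γ F ⊆ F ∧
      C.Eqq (C.thick q γ F) F ∧
      (∀ F' : Set X, C.QClosed q γ F' → C.Eqq F' F → C.thick q γ F ⊆ F')) := by
  have hq1 : 1 ≤ q := by
    have hN' : (2 : ℝ) ≤ N := by exact_mod_cast hN
    refine le_trans ?_ hq
    rw [le_div_iff₀ (by linarith)]
    linarith
  refine ⟨fun Q hQ => ?_, fun F hF => hC.thick_of_qClosed hq1 hF⟩
  obtain ⟨h₁, h₂, h₃, h₄⟩ := hC.thick_of_qClosed hq1 hQ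
  refine ⟨?_, subset_compl_comm.1 h₂, ?_, fun Q' hQ' h => subset_compl_comm.1 (h₄ _ hQ' h.compl)⟩
  · rwa [Capacity.QOpen, compl_compl]
  · simpa using h₃.compl
end
end

section
/- Let C be an admissible capacity on X. Let E ⊆ X be a q-closed set with C(E) > 0 and let D ⊆ X be an open set with C(E∖D) = 0. Then E∩D is q-quasi closed (it admits an increasing sequence of compact subsets K_m with C((E∩D)∖K_m) → 0), and there exists a q-open set O ⊆ X such that E ⊆q O and Õ ⊆q D. -/
open Set Metric Filter MeasureTheory ENNReal

noncomputable section

variable {X : Type*} [MetricSpace X]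

namespace Capacity

lemma union_le_s11 (C : Capacity X) (A B : Set X) :
    C.toFun (A ∪ B) ≤ C.toFun A + C.toFun B := by
  have h := C.subadd' (fun n => if n = 0 then A else if n = 1 then B else ∅)
  refine (C.mono' ?_).trans (h.trans ?_)
  · rintro x (hx | hx)
    · exact mem_iUnion.2 ⟨0, by simpa using hx⟩
    · exact mem_iUnion.2 ⟨1, by simpa using hx⟩
  · rw [tsum_eq_sum (s := Finset.range 2)]
    · simp [Finset.sum_range_succ]
    · intro n hn
      simp only [Finset.mem_range, not_lt] at hn
      rw [if_neg (by omega), if_neg (by omega), C.empty']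

lemma thick_mono (C : Capacity X) {q γ : ℝ} (hq : 1 < q) {A B : Set X} (h : A ⊆ B) :
    C.thick q γ A ⊆ C.thick q γ B := by
  intro ξ hξ
  refine top_unique (le_trans (le_of_eq (Eq.symm hξ)) (ENNReal.tsum_le_tsum fun n => ?_))
  have := C.mono' (inter_subset_inter_left (closedBall ξ ((2 : ℝ) ^ (-(n : ℝ)))) h)
  exact ENNReal.rpow_le_rpow (mul_le_mul_right this _) (by linarith)

lemma thick_union_subset (C : Capacity X) {q γ : ℝ} (hq : 1 < q) (A B : Set X) :
    C.thick q γ (A ∪ B) ⊆ C.thick q γ A ∪ C.thick q γ B := by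
  intro ξ hξ
  by_contra hcon
  rw [mem_union, not_or] at hcon
  obtain ⟨hA, hB⟩ := hcon
  have hq' : 0 ≤ q - 1 := by linarith
  refine ENNReal.mul_ne_top (ENNReal.rpow_ne_top_of_nonneg hq' (ofNat_ne_top (n := 2)))
    (ENNReal.add_ne_top.2 ⟨hA, hB⟩) (top_unique (le_trans (le_of_eq (Eq.symm hξ)) ?_))
  rw [← ENNReal.tsum_add, ← ENNReal.tsum_mul_left]
  refine ENNReal.tsum_le_tsum fun n => ?_
  set r := closedBall ξ ((2 : ℝ) ^ (-(n : ℝ)))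
  set w := (2 : ℝ≥0∞) ^ ((n : ℝ) * γ)
  set a := w * C.toFun (A ∩ r)
  set b := w * C.toFun (B ∩ r)
  have hab : w * C.toFun ((A ∪ B) ∩ r) ≤ 2 * max a b := by
    rw [union_inter_distrib_right]
    calc w * C.toFun (A ∩ r ∪ B ∩ r) ≤ w * (C.toFun (A ∩ r) + C.toFun (B ∩ r)) :=
          mul_le_mul_right (C.union_le_s11 _ _) _
      _ = a + b := mul_add _ _ _
      _ ≤ 2 * max a b := by
          rw [two_mul]; exact add_le_add (le_max_left _ _) (le_max_right _ _)
  refine (ENNReal.rpow_le_rpow hab hq').trans ?_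
  rw [ENNReal.mul_rpow_of_nonneg _ _ hq']
  refine mul_le_mul_right ?_ _
  rcases le_total a b with h | h
  · rw [max_eq_right h]; exact le_add_self
  · rw [max_eq_left h]; exact le_self_add

lemma qClosed_of_isClosed (C : Capacity X) (hfin : C.toFun univ ≠ ⊤) {q γ : ℝ} (hq : 1 < q)
    {F : Set X} (hF : IsClosed F) : C.QClosed q γ F := by
  intro ξ hξ
  by_contra hmem
  obtain ⟨ε, hε, hball⟩ := Metric.isOpen_iff.1 hF.isOpen_compl ξ hmem
  obtain ⟨n₀, hn₀⟩ := exists_pow_lt_of_lt_one hε (by norm_num : (1 / 2 : ℝ) < 1)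
  have hq' : 0 < q - 1 := by linarith
  refine absurd hξ ?_
  change ¬ (_ = _)
  rw [tsum_eq_sum (s := Finset.range n₀)]
  · refine ENNReal.sum_ne_top.2 fun n _ => ENNReal.rpow_ne_top_of_nonneg hq'.le
      (ENNReal.mul_ne_top ?_ (ne_top_of_le_ne_top hfin (C.mono' (subset_univ _))))
    exact ENNReal.rpow_ne_top_of_ne_zero (by norm_num) (by norm_num)
  · intro n hn
    simp only [Finset.mem_range, not_lt] at hn
    have hr : (2 : ℝ) ^ (-(n : ℝ)) < ε := by
      rw [Real.rpow_neg (by norm_num), Real.rpow_natCast, ← inv_pow, ← one_div]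
      exact (pow_le_pow_of_le_one (by norm_num) (by norm_num) hn).trans_lt hn₀
    have : F ∩ closedBall ξ ((2 : ℝ) ^ (-(n : ℝ))) = ∅ := by
      ext x
      simp only [mem_inter_iff, mem_empty_iff_false, iff_false, not_and]
      exact fun hx hxb => hball (closedBall_subset_ball hr hxb) hx
    rw [this, C.empty', mul_zero, ENNReal.zero_rpow_of_pos hq']

lemma qOpen_of_isOpen (C : Capacity X) (hfin : C.toFun univ ≠ ⊤) {q γ : ℝ} (hq : 1 < q)
    {O : Set X} (hO : IsOpen O) : C.QOpen q γ O :=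
  C.qClosed_of_isClosed hfin hq hO.isClosed_compl

lemma fineClosure_subset_of_subset_union (C : Capacity X) (hfin : C.toFun univ ≠ ⊤) {q γ : ℝ}
    (hq : 1 < q) {O F G : Set X} (hF : IsClosed F) (h : O ⊆ F ∪ G) :
    C.fineClosure q γ O ⊆ F ∪ C.fineClosure q γ G := by
  rintro x (hx | hx)
  · exact union_subset_union_right F subset_union_left (h hx)
  · rcases C.thick_union_subset hq F G (C.thick_mono hq h hx) with hx | hx
    · exact Or.inl (C.qClosed_of_isClosed hfin hq hF hx)
    · exact Or.inr (Or.inr hx)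

lemma exists_isOpen_le_add (C : Capacity X)
    (hout : ∀ E : Set X, C.toFun E = ⨅ (G : Set X) (_ : E ⊆ G) (_ : IsOpen G), C.toFun G)
    (hfin : C.toFun univ ≠ ⊤) (A : Set X) {ε : ℝ≥0∞} (hε : ε ≠ 0) :
    ∃ G, A ⊆ G ∧ IsOpen G ∧ C.toFun G ≤ C.toFun A + ε := by
  have hlt : C.toFun A < C.toFun A + ε :=
    ENNReal.lt_add_right (ne_top_of_le_ne_top hfin (C.mono' (subset_univ _))) hε
  rw [hout A] at hlt
  simp only [iInf_lt_iff] at hlt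
  obtain ⟨G, hAG, hG, hGlt⟩ := hlt
  exact ⟨G, hAG, hG, by rw [hout A]; exact hGlt.le⟩

lemma exists_isOpen_tendsto_zero (C : Capacity X)
    (hout : ∀ E : Set X, C.toFun E = ⨅ (G : Set X) (_ : E ⊆ G) (_ : IsOpen G), C.toFun G)
    (hfin : C.toFun univ ≠ ⊤) {A : ℕ → Set X}
    (hA : Tendsto (fun m => C.toFun (A m)) atTop (nhds 0)) :
    ∃ G : ℕ → Set X, (∀ m, A m ⊆ G m) ∧ (∀ m, IsOpen (G m)) ∧
      Tendsto (fun m => C.toFun (G m)) atTop (nhds 0) := by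
  choose G hAG hG hle using fun m : ℕ => C.exists_isOpen_le_add hout hfin (A m)
    (ENNReal.inv_ne_zero.2 (ENNReal.natCast_ne_top m))
  refine ⟨G, hAG, hG, tendsto_of_tendsto_of_tendsto_of_le_of_le tendsto_const_nhds ?_
    (fun _ => zero_le) hle⟩
  simpa using hA.add ENNReal.tendsto_inv_nat_nhds_zero

lemma QuasiClosed.inter_of_isOpen {C : Capacity X}
    (hout : ∀ E : Set X, C.toFun E = ⨅ (G : Set X) (_ : E ⊆ G) (_ : IsOpen G), C.toFun G)
    (hfin : C.toFun univ ≠ ⊤) {E D : Set X} (hE : C.QuasiClosed E)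
    (hED : C.toFun (E \ D) = 0) : C.QuasiClosed (E ∩ D) := by
  obtain ⟨K, hKmono, hKc, hKE, hKt⟩ := hE
  obtain ⟨G, hEG, hG, hGt⟩ := C.exists_isOpen_tendsto_zero hout hfin
    (A := fun _ => E \ D) (by simp [hED])
  refine ⟨fun m => K m \ ⋂ j ∈ Finset.range (m + 1), G j, ?_, ?_, ?_, ?_⟩
  · intro m n hmn
    refine sdiff_subset_sdiff (hKmono hmn) (biInter_subset_biInter_left
      (Finset.range_mono (Nat.succ_le_succ hmn)))
  · exact fun m => (hKc m).diff (isOpen_biInter_finset fun j _ => hG j)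
  · rintro m x ⟨hxK, hxG⟩
    refine ⟨hKE m hxK, by_contra fun hxD => hxG ?_⟩
    exact mem_iInter₂.2 fun j _ => hEG j ⟨hKE m hxK, hxD⟩
  · refine tendsto_of_tendsto_of_tendsto_of_le_of_le tendsto_const_nhds
      (by simpa using hKt.add hGt) (fun _ => zero_le) fun m =>
        (C.mono' ?_).trans (C.union_le_s11 (E \ K m) (G m))
    rintro x ⟨⟨hxE, -⟩, hx⟩
    by_cases hxK : x ∈ K m
    · right
      by_contra hxG
      exact hx ⟨hxK, fun h => hxG (mem_iInter₂.1 h m (by simp))⟩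
    · exact Or.inl ⟨hxE, hxK⟩

lemma QuasiClosed.exists_isOpen_fineClosure_subq [CompactSpace X] {C : Capacity X}
    (hout : ∀ E : Set X, C.toFun E = ⨅ (G : Set X) (_ : E ⊆ G) (_ : IsOpen G), C.toFun G)
    (hfin : C.toFun univ ≠ ⊤) {q γ : ℝ} (hq : 1 < q) {c : ℝ≥0∞} (hc : c ≠ ⊤)
    (hcl : ∀ A : Set X, C.toFun (C.fineClosure q γ A) ≤ c * C.toFun A)
    {A D : Set X} (hA : C.QuasiClosed A) (hD : IsOpen D) (hAD : A ⊆ D) :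
    ∃ O, IsOpen O ∧ C.Subq A O ∧ C.Subq (C.fineClosure q γ O) D := by
  obtain ⟨K, hKmono, hKc, hKA, hKt⟩ := hA
  obtain ⟨G, hAG, hG, hGt⟩ := C.exists_isOpen_tendsto_zero hout hfin hKt
  choose V hV hKV hVD using fun m =>
    normal_exists_closure_subset (hKc m).isClosed hD ((hKA m).trans hAD)
  set O := ⋃ m, V m ∩ ⋂ j ∈ Finset.range m, G j with hO
  have hKO : ∀ m, K m ⊆ O := by
    intro m x hx
    classical
    have hex : ∃ m, x ∈ K m := ⟨m, hx⟩
    refine mem_iUnion.2 ⟨Nat.find hex, hKV _ (Nat.find_spec hex), mem_iInter₂.2 fun j hj => ?_⟩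
    have hj' := Nat.find_min hex (Finset.mem_range.1 hj)
    exact hAG j ⟨hKA m hx, hj'⟩
  refine ⟨O, isOpen_iUnion fun m => (hV m).inter (isOpen_biInter_finset fun j _ => hG j), ?_, ?_⟩
  · exact le_antisymm (ge_of_tendsto' hKt fun m => C.mono' (sdiff_subset_sdiff_right (hKO m)))
      zero_le
  · have hsub : ∀ m, O ⊆ (⋃ i ∈ Finset.range (m + 1), closure (V i)) ∪ G m := by
      intro m x hx
      obtain ⟨i, hxV, hxG⟩ := mem_iUnion.1 hx
      rcases Nat.lt_or_ge m i with h | h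
      · exact Or.inr (mem_iInter₂.1 hxG m (Finset.mem_range.2 h))
      · exact Or.inl (mem_iUnion₂.2
          ⟨i, Finset.mem_range.2 (Nat.lt_succ_of_le h), subset_closure hxV⟩)
    have hlim : Tendsto (fun m => c * C.toFun (G m)) atTop (nhds 0) := by
      simpa using ENNReal.Tendsto.const_mul hGt (Or.inr hc)
    refine le_antisymm (ge_of_tendsto' hlim fun m => (C.mono' ?_).trans (hcl (G m))) zero_le
    rintro x ⟨hx, hxD⟩
    have hclosed : IsClosed (⋃ i ∈ Finset.range (m + 1), closure (V i)) :=
      isClosed_biUnion_finset fun i _ => isClosed_closure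
    refine (C.fineClosure_subset_of_subset_union hfin hq hclosed (hsub m) hx).resolve_left
      fun h => ?_
    obtain ⟨i, -, hi⟩ := mem_iUnion₂.1 h
    exact hxD (hVD i hi)

end Capacity

theorem stmt11 {X : Type*} [MetricSpace X] [CompactSpace X] [MeasurableSpace X] [BorelSpace X]
    (N : ℕ) (hN : 2 ≤ N) (q γ : ℝ) (hq : ((N : ℝ) + 1) / ((N : ℝ) - 1) ≤ q)
    (hγ : γ = (N : ℝ) - 1 - 2 / (q - 1))
    (C : Capacity X) (hC : C.Admissible q γ)
    (E : Set X) (hE : C.QClosed q γ E) (hEpos : 0 < C.toFun E)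
    (D : Set X) (hD : IsOpen D) (hED : C.toFun (E \ D) = 0) :
    C.QuasiClosed (E ∩ D) ∧
    ∃ O : Set X, C.QOpen q γ O ∧ C.Subq E O ∧ C.Subq (C.fineClosure q γ O) D := by
  have hq1 : 1 < q := by
    have hN' : (2 : ℝ) ≤ N := by exact_mod_cast hN
    refine lt_of_lt_of_le ?_ hq
    rw [lt_div_iff₀ (by linarith)]
    linarith
  have hquasi : C.QuasiClosed (E ∩ D) :=
    (hC.stratification E hE).inter_of_isOpen hC.outerRegular hC.finite hED
  obtain ⟨c, -, hc, hcl⟩ := hC.closureBound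
  obtain ⟨O, hO, hEO, hOD⟩ := hquasi.exists_isOpen_fineClosure_subq hC.outerRegular hC.finite hq1
    hc hcl hD inter_subset_right
  refine ⟨hquasi, O, C.qOpen_of_isOpen hC.finite hq1 hO, ?_, hOD⟩
  refine le_antisymm ((C.mono' (B := E \ D ∪ (E ∩ D) \ O) ?_).trans
    ((C.union_le_s11 _ _).trans (by rw [hED, hEO, add_zero]))) zero_le
  rintro x ⟨hxE, hxO⟩
  by_cases hxD : x ∈ D
  · exact Or.inr ⟨⟨hxE, hxD⟩, hxO⟩
  · exact Or.inl ⟨hxE, hxD⟩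
end
end

section
/- Let C be an admissible capacity on X, let E ⊆ X be q-closed, and let 𝒟 be a family of q-open subsets of X with E ⊆ ⋃𝒟. Then for every ε > 0 there exist an open set O_ε ⊆ X with C(O_ε) < ε and finitely many sets D_1, …, D_k ∈ 𝒟 such that E∖O_ε ⊆ D_1 ∪ … ∪ D_k. -/
open Set Metric Filter MeasureTheory ENNReal

noncomputable section

variable {X : Type*} [MetricSpace X]

/-- A capacity, regarded as an outer measure. -/
def Capacity.toOuterMeasure (C : Capacity X) : OuterMeasure X where
  measureOf := C.toFun
  empty := C.empty'
  mono {_ _} h := C.mono' h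
  iUnion_nat A _ := C.subadd' A

theorem Capacity.iUnion_le (C : Capacity X) {ι : Type*} [Countable ι] (A : ι → Set X) :
    C.toFun (⋃ i, A i) ≤ ∑' i, C.toFun (A i) :=
  measure_iUnion_le (μ := C.toOuterMeasure) A

theorem Capacity.Admissible.exists_isOpen_lt [CompactSpace X] [MeasurableSpace X] [BorelSpace X]
    {C : Capacity X} {q γ : ℝ} (hC : C.Admissible q γ) {A : Set X} {δ : ℝ≥0∞}
    (hA : C.toFun A < δ) : ∃ G, A ⊆ G ∧ IsOpen G ∧ C.toFun G < δ := by
  rw [hC.outerRegular A] at hA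
  simpa only [iInf_lt_iff, exists_prop] using hA

theorem stmt13 {X : Type*} [MetricSpace X] [CompactSpace X] [MeasurableSpace X] [BorelSpace X]
    (N : ℕ) (hN : 2 ≤ N) (q γ : ℝ) (hq : ((N : ℝ) + 1) / ((N : ℝ) - 1) ≤ q)
    (hγ : γ = (N : ℝ) - 1 - 2 / (q - 1))
    (C : Capacity X) (hC : C.Admissible q γ)
    (E : Set X) (hE : C.QClosed q γ E)
    (𝒟 : Set (Set X)) (h𝒟 : ∀ D ∈ 𝒟, C.QOpen q γ D) (hcover : E ⊆ ⋃₀ 𝒟)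
    (ε : ℝ≥0∞) (hε : 0 < ε) :
    ∃ O : Set X, IsOpen O ∧ C.toFun O < ε ∧
      ∃ 𝒟' : Finset (Set X), ↑𝒟' ⊆ 𝒟 ∧ E \ O ⊆ ⋃₀ ↑𝒟' := by
  have hδ : 0 < ε / 3 := ENNReal.div_pos hε.ne' (by simp)
  obtain ⟨S, hS, hScount, hSnull⟩ := hC.quasiLindelof 𝒟 h𝒟
  have : Countable S := hScount.to_subtype
  obtain ⟨U, hAU, hU, hCU⟩ := hC.exists_isOpen_lt (hSnull.trans_lt hδ)
  obtain ⟨K, -, hK, hKE, hKlim⟩ := hC.stratification E hE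
  obtain ⟨m, hm⟩ := (hKlim.eventually_lt_const hδ).exists
  obtain ⟨G, hEG, hG, hCG⟩ := hC.exists_isOpen_lt hm
  obtain ⟨δ, hδpos, hδsum⟩ := ENNReal.exists_pos_sum_of_countable' hδ.ne' S
  choose ω hω hCω hDω using fun D : S => hC.openPatch D (h𝒟 D (hS D.2)) (δ D) (hδpos D)
  have hCW : C.toFun (⋃ D, ω D) < ε / 3 :=
    ((C.iUnion_le ω).trans (ENNReal.tsum_le_tsum fun D => (hCω D).le)).trans_lt hδsum
  have hcpt : IsCompact (K m \ (U ∪ G ∪ ⋃ D, ω D)) :=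
    (hK m).diff ((hU.union hG).union (isOpen_iUnion hω))
  obtain ⟨t, ht⟩ := hcpt.elim_finite_subcover (fun D : S => (D : Set X) ∪ ω D) hDω (by
    rintro x ⟨hxK, hxO⟩
    have hxS : x ∈ ⋃₀ S := by
      by_contra hx
      exact hxO (Or.inl (Or.inl (hAU ⟨hcover (hKE m hxK), hx⟩)))
    obtain ⟨D, hD, hxD⟩ := hxS
    exact mem_iUnion.2 ⟨⟨D, hD⟩, Or.inl hxD⟩)
  refine ⟨U ∪ G ∪ ⋃ D, ω D, (hU.union hG).union (isOpen_iUnion hω), ?_,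
    t.map (Function.Embedding.subtype _), ?_, ?_⟩
  · calc C.toFun (U ∪ G ∪ ⋃ D, ω D)
        ≤ C.toFun U + C.toFun G + C.toFun (⋃ D, ω D) :=
          (C.union_le _ _).trans (by gcongr; exact C.union_le U G)
      _ < ε / 3 + ε / 3 + ε / 3 := ENNReal.add_lt_add (ENNReal.add_lt_add hCU hCG) hCW
      _ = ε := ENNReal.add_thirds ε
  · intro D hD
    obtain ⟨D, -, rfl⟩ := Finset.mem_map.1 hD
    exact hS D.2
  · rintro x ⟨hxE, hxO⟩
    have hxK : x ∈ K m := by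
      by_contra hx
      exact hxO (Or.inl (Or.inr (hEG ⟨hxE, hx⟩)))
    obtain ⟨D, hDt, hxD⟩ := mem_iUnion₂.1 (ht ⟨hxK, hxO⟩)
    refine ⟨D, Finset.mem_map_of_mem _ hDt, hxD.resolve_right fun hx => ?_⟩
    exact hxO (Or.inr (mem_iUnion.2 ⟨D, hx⟩))
end
end

section
/- Let C be an admissible capacity on X, let Q ⊆ X be q-open, and let ξ ∈ Q. Then there exists a q-open set Q_ξ ⊆ X such that ξ ∈ Q_ξ and the q-fine closure Q̃_ξ is contained in Q. -/
open Set Metric Filter MeasureTheory ENNReal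

noncomputable section

variable {X : Type*} [MetricSpace X]

/-- Closed sets are `q`-closed for a finite capacity: a set avoiding a ball around `x`
is thin at `x`. -/
theorem Capacity.thick_subset_of_isClosed {X : Type*} [MetricSpace X] (C : Capacity X)
    (hfin : C.toFun univ ≠ ⊤) {q : ℝ} (γ : ℝ) (hq : 1 < q) {F : Set X} (hF : IsClosed F) :
    C.thick q γ F ⊆ F := by
  intro x hx
  by_contra hxF
  have hp : 0 < q - 1 := sub_pos.2 hq
  obtain ⟨r, hr, hball⟩ := Metric.isOpen_iff.1 hF.isOpen_compl x hxF
  obtain ⟨M, hM⟩ := exists_pow_lt_of_lt_one hr (by norm_num : (2 : ℝ)⁻¹ < 1)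
  have hzero : ∀ n ∉ Finset.range M,
      ((2 : ℝ≥0∞) ^ ((n : ℝ) * γ) *
        C.toFun (F ∩ closedBall x ((2 : ℝ) ^ (-(n : ℝ))))) ^ (q - 1) = 0 := by
    intro n hn
    have hMn : M ≤ n := by simpa using hn
    have hlt : (2 : ℝ) ^ (-(n : ℝ)) < r := by
      rw [Real.rpow_neg zero_le_two, Real.rpow_natCast, ← inv_pow]
      exact (pow_le_pow_of_le_one (by norm_num) (by norm_num) hMn).trans_lt hM
    have hempty : F ∩ closedBall x ((2 : ℝ) ^ (-(n : ℝ))) = ∅ := by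
      ext y
      simp only [mem_inter_iff, mem_empty_iff_false, iff_false, not_and]
      exact fun hy hyb => hball (closedBall_subset_ball hlt hyb) hy
    rw [hempty, C.empty', mul_zero, ENNReal.zero_rpow_of_pos hp]
  have hx' := hx
  simp only [Capacity.thick, mem_ofPred_eq] at hx'
  rw [tsum_eq_sum hzero] at hx'
  refine absurd hx' (ENNReal.sum_ne_top.2 fun n _ => ?_)
  refine ENNReal.rpow_ne_top_of_nonneg hp.le (ENNReal.mul_ne_top ?_ ?_)
  · exact ENNReal.rpow_ne_top_of_ne_zero two_ne_zero ofNat_ne_top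
  · exact ne_top_of_le_ne_top hfin (C.mono' (subset_univ _))

/-- A set which is thin at a point `ξ` outside of it has an open superset
which avoids `ξ` and is thin at `ξ`. -/
theorem Capacity.exists_isOpen_superset_notMem_thick {X : Type*} [MetricSpace X]
    (C : Capacity X) (hfin : C.toFun univ ≠ ⊤)
    (hout : ∀ E : Set X, C.toFun E = ⨅ (G : Set X) (_ : E ⊆ G) (_ : IsOpen G), C.toFun G)
    {q γ : ℝ} (hq : 1 < q) {F : Set X} {ξ : X} (hξF : ξ ∉ F) (hξ : ξ ∉ C.thick q γ F) :
    ∃ V : Set X, IsOpen V ∧ F ⊆ V ∧ ξ ∉ V ∧ ξ ∉ C.thick q γ V := by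
  have hp : 0 < q - 1 := sub_pos.2 hq
  set B : ℕ → Set X := fun n => closedBall ξ ((2 : ℝ) ^ (-(n : ℝ))) with hB
  have hBanti : Antitone B := fun m n hmn =>
    closedBall_subset_closedBall
      (Real.rpow_le_rpow_of_exponent_le one_le_two (neg_le_neg (Nat.cast_le.2 hmn)))
  set f : ℕ → ℝ≥0∞ → ℝ≥0∞ :=
    fun n t => ((2 : ℝ≥0∞) ^ ((n : ℝ) * γ) * t) ^ (q - 1) with hf
  have hcoef : ∀ n : ℕ, (2 : ℝ≥0∞) ^ ((n : ℝ) * γ) ≠ ⊤ := fun n =>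
    ENNReal.rpow_ne_top_of_ne_zero two_ne_zero ofNat_ne_top
  have hfmono : ∀ n, Monotone (f n) := fun n s t hst =>
    ENNReal.rpow_le_rpow (mul_le_mul_right hst _) hp.le
  have hfcont : ∀ n, Continuous (f n) := fun n =>
    ENNReal.continuous_rpow_const.comp (ENNReal.continuous_const_mul (hcoef n))
  have hsum : ∑' n, f n (C.toFun (F ∩ B n)) ≠ ⊤ := hξ
  have hG : ∀ n : ℕ, ∃ G : Set X, F ∩ B n ⊆ G ∧ IsOpen G ∧
      f n (C.toFun G) ≤ f n (C.toFun (F ∩ B n)) + (2 : ℝ≥0∞)⁻¹ ^ n := by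
    intro n
    have hne : f n (C.toFun (F ∩ B n)) ≠ ⊤ := ENNReal.ne_top_of_tsum_ne_top hsum n
    have hlt : f n (C.toFun (F ∩ B n)) < f n (C.toFun (F ∩ B n)) + (2 : ℝ≥0∞)⁻¹ ^ n :=
      ENNReal.lt_add_right hne (pow_ne_zero _ (by simp))
    have htop : C.toFun (F ∩ B n) < ⊤ :=
      (C.mono' (subset_univ _)).trans_lt (lt_top_iff_ne_top.2 hfin)
    obtain ⟨b, hb, hbsub⟩ := exists_Ico_subset_of_mem_nhds
      ((hfcont n).continuousAt.eventually_lt_const hlt) ⟨⊤, htop⟩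
    have hb' := hb
    rw [hout (F ∩ B n)] at hb'
    simp only [iInf_lt_iff] at hb'
    obtain ⟨G, hFG, hGo, hGb⟩ := hb'
    exact ⟨G, hFG, hGo, (hbsub ⟨C.mono' hFG, hGb⟩ : _ < _).le⟩
  choose G hFG hGo hGle using hG
  refine ⟨⋃ M : ℕ, (B M)ᶜ ∩ ⋂ n ∈ Finset.range M, ((B n)ᶜ ∪ G n), ?_, ?_, ?_, ?_⟩
  · exact isOpen_iUnion fun M => isClosed_closedBall.isOpen_compl.inter
      (isOpen_biInter_finset fun n _ => isClosed_closedBall.isOpen_compl.union (hGo n))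
  · intro x hx
    have hd : 0 < dist x ξ := dist_pos.2 fun h => hξF (h ▸ hx)
    obtain ⟨M, hM⟩ := exists_pow_lt_of_lt_one hd (by norm_num : (2 : ℝ)⁻¹ < 1)
    refine mem_iUnion.2 ⟨M, ?_, mem_iInter₂.2 fun n _ => ?_⟩
    · simpa [hB, Real.rpow_neg, inv_pow] using hM
    · by_cases hxn : x ∈ B n
      · exact Or.inr (hFG n ⟨hx, hxn⟩)
      · exact Or.inl hxn
  · intro h
    obtain ⟨M, hM, -⟩ := mem_iUnion.1 h
    exact hM (mem_closedBall_self (by positivity))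
  · refine ne_top_of_le_ne_top (b := ∑' n, (f n (C.toFun (F ∩ B n)) + (2 : ℝ≥0∞)⁻¹ ^ n)) ?_
      (ENNReal.tsum_le_tsum fun n => (hfmono n (C.mono' ?_)).trans (hGle n))
    · rw [ENNReal.tsum_add]
      refine ENNReal.add_ne_top.2 ⟨hsum, ?_⟩
      simp [ENNReal.tsum_geometric]
    · rintro x ⟨hxV, hxn⟩
      obtain ⟨M, hM, hx⟩ := mem_iUnion.1 hxV
      have hnM : n < M := lt_of_not_ge fun h => hM (hBanti h hxn)
      exact (mem_iInter₂.1 hx n (Finset.mem_range.2 hnM)).resolve_left fun h => h hxn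

theorem stmt16 {X : Type*} [MetricSpace X] [CompactSpace X] [MeasurableSpace X] [BorelSpace X]
    (N : ℕ) (hN : 2 ≤ N) (q γ : ℝ) (hq : ((N : ℝ) + 1) / ((N : ℝ) - 1) ≤ q)
    (hγ : γ = (N : ℝ) - 1 - 2 / (q - 1))
    (C : Capacity X) (hC : C.Admissible q γ)
    (Q : Set X) (hQ : C.QOpen q γ Q) (ξ : X) (hξ : ξ ∈ Q) :
    ∃ Qξ : Set X, C.QOpen q γ Qξ ∧ ξ ∈ Qξ ∧ C.fineClosure q γ Qξ ⊆ Q := by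
  have hN' : (2 : ℝ) ≤ N := by exact_mod_cast hN
  have hq1 : 1 < q := lt_of_lt_of_le ((one_lt_div (by linarith)).2 (by linarith)) hq
  obtain ⟨V, hVo, hFV, hξV, hξt⟩ :=
    C.exists_isOpen_superset_notMem_thick hC.finite hC.outerRegular hq1
      (F := Qᶜ) (ξ := ξ) (fun h => h hξ) (fun h => hQ h hξ)
  have hthick : C.thick q γ (C.fineClosure q γ V)ᶜ ⊆ Vᶜ := by
    refine Subset.trans (fun x hx => ?_)
      (C.thick_subset_of_isClosed hC.finite γ hq1 hVo.isClosed_compl)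
    refine top_le_iff.1 ((top_le_iff.2 hx).trans (ENNReal.tsum_le_tsum fun n => ?_))
    refine ENNReal.rpow_le_rpow (mul_le_mul_right (C.mono' ?_) _) (by linarith)
    exact inter_subset_inter_left _ (compl_subset_compl.2 subset_union_left)
  refine ⟨(C.fineClosure q γ V)ᶜ, ?_, fun h => h.elim hξV hξt, ?_⟩
  · rw [Capacity.QOpen, compl_compl]
    exact hC.closureQClosed V
  · exact (union_subset (compl_subset_compl.2 subset_union_left) hthick).trans
      (compl_subset_comm.1 hFV)
end
end

section
/- Let C be a capacity on X, let μ₀ be a Borel measure on X that is essentially absolutely continuous with respect to C, and let Q ⊆ X be a q-open set with μ₀(Q) < ∞. Then μ₀ restricted to Q is absolutely continuous with respect to C in the strong sense: for every sequence (A_n) of Borel subsets of X with C(A_n) → 0, one has μ₀(Q ∩ A_n) → 0. -/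
open Set Metric Filter MeasureTheory ENNReal

noncomputable section

variable {X : Type*} [MetricSpace X]

/-- The upper limit of a sequence of sets whose capacities are summable has capacity zero. -/
theorem Capacity.toFun_iInter_iUnion_add_eq_zero (C : Capacity X) {B : ℕ → Set X}
    (hB : ∑' k, C.toFun (B k) ≠ ⊤) : C.toFun (⋂ n, ⋃ k, B (k + n)) = 0 := by
  refine le_antisymm (ge_of_tendsto' (ENNReal.tendsto_sum_nat_add _ hB) fun n => ?_) zero_le
  exact (C.mono' (iInter_subset _ n)).trans (C.subadd' fun k => B (k + n))

/-- If a finite measure vanishes on the measurable sets of capacity zero, then it tends to zero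
along every sequence of measurable sets with summable capacities. -/
theorem Capacity.tendsto_measure_of_tsum_ne_top [MeasurableSpace X] (C : Capacity X)
    (ν : Measure X) [IsFiniteMeasure ν]
    (hν : ∀ A, MeasurableSet A → C.toFun A = 0 → ν A = 0) {B : ℕ → Set X}
    (hBm : ∀ k, MeasurableSet (B k)) (hB : ∑' k, C.toFun (B k) ≠ ⊤) :
    Tendsto (fun k => ν (B k)) atTop (nhds 0) := by
  have hm : ∀ n, MeasurableSet (⋃ k, B (k + n)) := fun n => MeasurableSet.iUnion fun k => hBm _
  have hanti : Antitone fun n => ⋃ k, B (k + n) := by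
    intro m n hmn
    refine iUnion_subset fun k => ?_
    refine subset_iUnion_of_subset (k + (n - m)) ?_
    rw [show k + (n - m) + m = k + n by omega]
  have hlim := tendsto_measure_iInter_atTop (μ := ν) (fun n => (hm n).nullMeasurableSet) hanti
    ⟨0, measure_ne_top _ _⟩
  rw [hν _ (MeasurableSet.iInter hm) (C.toFun_iInter_iUnion_add_eq_zero hB)] at hlim
  refine tendsto_of_tendsto_of_tendsto_of_le_of_le tendsto_const_nhds hlim
    (fun _ => zero_le) fun n => measure_mono ?_
  exact subset_iUnion_of_subset 0 (by rw [zero_add])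

/-- If a finite measure vanishes on the measurable sets of capacity zero, then it tends to zero
along every sequence of measurable sets whose capacities tend to zero. -/
theorem Capacity.tendsto_measure_zero [MeasurableSpace X] (C : Capacity X)
    (ν : Measure X) [IsFiniteMeasure ν]
    (hν : ∀ A, MeasurableSet A → C.toFun A = 0 → ν A = 0) {A : ℕ → Set X}
    (hA : ∀ n, MeasurableSet (A n)) (hA0 : Tendsto (fun n => C.toFun (A n)) atTop (nhds 0)) :
    Tendsto (fun n => ν (A n)) atTop (nhds 0) := by
  refine tendsto_of_subseq_tendsto fun ns hns => ?_
  obtain ⟨δ, hδ, hδsum⟩ := ENNReal.exists_pos_sum_of_countable' one_ne_zero ℕ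
  have hsmall : ∀ k, ∃ m, C.toFun (A (ns m)) ≤ δ k := fun k =>
    ((hA0.comp hns).eventually_le_const (hδ k)).exists
  choose ms hms using hsmall
  exact ⟨ms, C.tendsto_measure_of_tsum_ne_top ν hν (fun k => hA _)
    ((ENNReal.tsum_le_tsum hms).trans_lt (hδsum.trans one_lt_top)).ne⟩

/-- The restriction of an essentially absolutely continuous measure to a `q`-open set of finite
measure vanishes on the Borel sets of capacity zero. -/
theorem Capacity.EssAbsCont.restrict_eq_zero [MeasurableSpace X] {C : Capacity X} {q γ : ℝ}
    {μ : Measure X} (hμ : C.EssAbsCont q γ μ) {Q : Set X} (hQ : C.QOpen q γ Q)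
    (hQfin : μ Q ≠ ⊤) {A : Set X} (hA : MeasurableSet A) (hA0 : C.toFun A = 0) :
    μ.restrict Q A = 0 := by
  rw [Measure.restrict_apply hA, inter_comm]
  have hsplit := measure_inter_add_sdiff (μ := μ) Q hA
  rw [hμ Q hQ A hA hA0] at hsplit
  refine (ENNReal.add_left_inj hQfin).1 ?_
  rw [hsplit, zero_add]

theorem stmt18 {X : Type*} [MetricSpace X] [CompactSpace X] [MeasurableSpace X] [BorelSpace X]
    (N : ℕ) (hN : 2 ≤ N) (q γ : ℝ) (hq : ((N : ℝ) + 1) / ((N : ℝ) - 1) ≤ q)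
    (hγ : γ = (N : ℝ) - 1 - 2 / (q - 1))
    (C : Capacity X) (μ₀ : Measure X) (hμ₀ : C.EssAbsCont q γ μ₀)
    (Q : Set X) (hQ : C.QOpen q γ Q) (hQfin : μ₀ Q < ⊤)
    (A : ℕ → Set X) (hA : ∀ n, MeasurableSet (A n))
    (hA0 : Tendsto (fun n => C.toFun (A n)) atTop (nhds 0)) :
    Tendsto (fun n => μ₀ (Q ∩ A n)) atTop (nhds 0) := by
  have : IsFiniteMeasure (μ₀.restrict Q) := ⟨by rwa [Measure.restrict_apply_univ]⟩
  have hlim := C.tendsto_measure_zero (μ₀.restrict Q)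
    (fun B hB hB0 => hμ₀.restrict_eq_zero hQ hQfin.ne hB hB0) hA hA0
  simpa only [Measure.restrict_apply (hA _), inter_comm] using hlim
end
end
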